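/- Krull dimension of a Heyting algebra (classical): let T be a Heyting algebra, S ⊆ T a generating subset (the smallest bounded sublattice of T containing S is T itself), and ℓ a natural number. Then the Krull dimension of T — Order.krullDim of the poset of prime ideals of the underlying bounded distributive lattice ordered by inclusion — is ≤ ℓ if and only if for all x₀, …, x_ℓ ∈ S one has t_ℓ = ⊤, where t₀ := x₀ ⊔ x₀ᶜ (with x₀ᶜ := x₀ ⇨ ⊥) and t_{i+1} := x_{i+1} ⊔ (x_{i+1} ⇨ t_i) for 0 ≤ i < ℓ; i.e. ⊤ = x_ℓ ⊔ (x_ℓ ⇨ (⋯ (x₁ ⊔ (x₁ ⇨ (x₀ ⊔ x₀ᶜ))) ⋯)). [Theorem 3.1.1, equivalence of items 1 and 5] -/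

import Mathlib

/-- The iterated expression `t_{i+1} = x_{i+1} ⊔ (x_{i+1} ⇨ t_i)`,
`t_0 = x_0 ⊔ (x_0 ⇨ ⊥)`. -/
def heytChain {T : Type*} [HeytingAlgebra T] (x : ℕ → T) : ℕ → T
  | 0 => x 0 ⊔ (x 0 ⇨ ⊥)
  | n + 1 => x (n + 1) ⊔ (x (n + 1) ⇨ heytChain x n)

namespace Order.Ideal

variable {T : Type*}

theorem IsPrime.inf_mem_iff [SemilatticeInf T] {I : Ideal T} (hI : I.IsPrime) {a b : T} :
    a ⊓ b ∈ I ↔ a ∈ I ∨ b ∈ I :=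
  ⟨hI.mem_or_mem, fun h => h.elim (I.lower inf_le_left) (I.lower inf_le_right)⟩

/-- Strictly comparable prime ideals are separated by an element of any generating set. -/
theorem exists_mem_notMem_of_lt [Lattice T] [BoundedOrder T] {S : Set T}
    (hS : latticeClosure (S ∪ {⊥, ⊤}) = Set.univ) {p q : Ideal T} (hp : p.IsPrime)
    (hq : q.IsPrime) (hpq : p < q) : ∃ s ∈ S, s ∈ q ∧ s ∉ p := by
  by_contra! h
  have hsub : IsSublattice {a : T | a ∈ p ↔ a ∈ q} :=
    ⟨fun a ha b hb => by simp_all, fun a ha b hb => by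
      simp_all [hp.inf_mem_iff, hq.inf_mem_iff]⟩
  have hgen : S ∪ {⊥, ⊤} ⊆ {a : T | a ∈ p ↔ a ∈ q} := by
    rintro a (ha | rfl | rfl)
    · exact ⟨fun hap => hpq.le hap, h a ha⟩
    · simp
    · exact iff_of_false hp.top_notMem hq.top_notMem
  have hall := latticeClosure_min hgen hsub
  rw [hS] at hall
  exact hpq.ne (SetLike.ext fun a => hall (Set.mem_univ a))

theorem exists_isPrime_mem_of_ne_top [DistribLattice T] [OrderTop T] {a : T} (ha : a ≠ ⊤) :
    ∃ p : Ideal T, p.IsPrime ∧ a ∈ p := by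
  obtain ⟨p, hp, hap, -⟩ := DistribLattice.prime_ideal_of_disjoint_filter_ideal
    (F := PFilter.principal (⊤ : T)) (I := principal a) <| by
      rw [Set.disjoint_left]
      intro z hz hza
      exact ha (top_le_iff.mp ((PFilter.mem_principal.mp hz).trans (mem_principal.mp hza)))
  exact ⟨p, hp, principal_le_iff.mp hap⟩

variable [HeytingAlgebra T]

/-- A prime ideal containing `x ⊔ (x ⇨ t)` strictly contains a prime ideal containing `t`. -/
theorem IsPrime.exists_lt_of_sup_himp_mem {p : Ideal T} (hp : p.IsPrime) {x t : T}
    (h : x ⊔ (x ⇨ t) ∈ p) : ∃ q : Ideal T, q.IsPrime ∧ q < p ∧ t ∈ q := by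
  have hF : IsPFilter {z : T | ∃ y, y ∉ p ∧ y ⊓ x ≤ z} := by
    refine .of_def ⟨⊤, ⊤, hp.top_notMem, le_top⟩ ?_ ?_
    · rintro a ⟨y, hy, hya⟩ b ⟨z, hz, hzb⟩
      refine ⟨a ⊓ b, ⟨y ⊓ z, fun hyz => (hp.mem_or_mem hyz).elim hy hz, ?_⟩,
        inf_le_left, inf_le_right⟩
      exact le_inf ((inf_le_inf_right x inf_le_left).trans hya)
        ((inf_le_inf_right x inf_le_right).trans hzb)
    · rintro a b hab ⟨y, hy, hya⟩
      exact ⟨y, hy, hya.trans hab⟩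
  obtain ⟨q, hq, htq, hdisj⟩ := DistribLattice.prime_ideal_of_disjoint_filter_ideal
    (F := hF.toPFilter) (I := principal t) <| by
      rw [Set.disjoint_left]
      rintro z ⟨y, hy, hyz⟩ hzt
      exact hy (p.lower ((le_himp_iff.mpr (hyz.trans hzt)).trans le_sup_right) h)
  rw [Set.disjoint_left] at hdisj
  have hxq : x ∉ q := fun hx => hdisj (a := x) ⟨⊤, hp.top_notMem, inf_le_right⟩ hx
  refine ⟨q, hq, SetLike.lt_iff_le_and_exists.mpr ⟨fun y hy => ?_, x,
    p.lower le_sup_left h, hxq⟩, principal_le_iff.mp htq⟩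
  by_contra hyp
  exact hdisj (a := y) ⟨y, hyp, inf_le_left⟩ hy

theorem IsPrime.sup_himp_mem {p q : Ideal T} (hp : p.IsPrime) (hpq : p ≤ q) {x t : T}
    (ht : t ∈ p) (hxp : x ∉ p) (hxq : x ∈ q) : x ⊔ (x ⇨ t) ∈ q :=
  sup_mem hxq <| hpq <|
    (hp.mem_or_mem (p.lower inf_himp_le ht)).resolve_left hxp

theorem exists_ltSeries_of_heytChain_mem (x : ℕ → T) (n : ℕ) :
    ∀ p : {I : Ideal T // I.IsPrime}, heytChain x n ∈ p.1 →
      ∃ l : LTSeries {I : Ideal T // I.IsPrime}, l.length = n + 1 ∧ l.last = p := by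
  induction n with
  | zero =>
    rintro ⟨p, hp⟩ h
    obtain ⟨q, hq, hqp, -⟩ := hp.exists_lt_of_sup_himp_mem h
    exact ⟨(RelSeries.singleton _ ⟨q, hq⟩).snoc ⟨p, hp⟩
      (by rw [RelSeries.last_singleton]; exact hqp), rfl, by simp⟩
  | succ n ih =>
    rintro ⟨p, hp⟩ h
    obtain ⟨q, hq, hqp, hmem⟩ := hp.exists_lt_of_sup_himp_mem h
    obtain ⟨l, hl, hlast⟩ := ih ⟨q, hq⟩ hmem
    exact ⟨l.snoc ⟨p, hp⟩ (by rw [hlast]; exact hqp), by simp [hl], by simp⟩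

/-- If each `x i` separates two consecutive members of a chain of prime ideals, then
`heytChain x i` lies in the larger one. -/
theorem heytChain_mem {n : ℕ} {p : ℕ → Ideal T} (hp : ∀ i ≤ n, (p i).IsPrime)
    (hle : ∀ i ≤ n, p i ≤ p (i + 1)) {x : ℕ → T}
    (hx : ∀ i ≤ n, x i ∈ p (i + 1) ∧ x i ∉ p i) : heytChain x n ∈ p (n + 1) := by
  induction n with
  | zero =>
    exact (hp 0 le_rfl).sup_himp_mem (hle 0 le_rfl) (bot_mem _) (hx 0 le_rfl).2 (hx 0 le_rfl).1
  | succ n ih =>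
    exact (hp _ le_rfl).sup_himp_mem (hle _ le_rfl)
      (ih (fun i hi => hp i (by lia)) (fun i hi => hle i (by lia)) fun i hi => hx i (by lia))
      (hx _ le_rfl).2 (hx _ le_rfl).1

end Order.Ideal

/-- Theorem 3.1.1 (items 1 ↔ 5): characterization of the Krull dimension of a
Heyting algebra by the identity
`⊤ = x_ℓ ⊔ (x_ℓ ⇨ (⋯ (x₁ ⊔ (x₁ ⇨ (x₀ ⊔ x₀ᶜ))) ⋯))`. -/
theorem krullDim_heyting_le_iff (T : Type*) [HeytingAlgebra T]
    (S : Set T) (hS : latticeClosure (S ∪ {⊥, ⊤}) = Set.univ) (ℓ : ℕ) :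
    Order.krullDim {I : Order.Ideal T // I.IsPrime} ≤ (ℓ : WithBot ℕ∞) ↔
      ∀ x : ℕ → T, (∀ i ≤ ℓ, x i ∈ S) → heytChain x ℓ = ⊤ := by
  rw [← ENat.WithBot.lt_add_one_iff, ← Nat.cast_add_one, Order.krullDim_lt_coe_iff]
  constructor
  · intro h x _
    by_contra hne
    obtain ⟨p, hp, hmem⟩ := Order.Ideal.exists_isPrime_mem_of_ne_top hne
    obtain ⟨l, hl, -⟩ := Order.Ideal.exists_ltSeries_of_heytChain_mem x ℓ ⟨p, hp⟩ hmem
    exact (h l).ne hl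
  · intro h l
    by_contra! hl
    let p : ℕ → {I : Order.Ideal T // I.IsPrime} := fun i => l (Fin.ofNat _ i)
    have hlt : ∀ i ≤ ℓ, p i < p (i + 1) := fun i hi => l.strictMono <| by
      rw [Fin.lt_def, Fin.val_ofNat, Fin.val_ofNat, Nat.mod_eq_of_lt (by lia),
        Nat.mod_eq_of_lt (by lia)]
      exact i.lt_succ_self
    choose! x hxS hx using fun i hi =>
      Order.Ideal.exists_mem_notMem_of_lt hS (p i).2 (p (i + 1)).2 (hlt i hi)
    have hmem := Order.Ideal.heytChain_mem (p := fun i => (p i).1) (fun i _ => (p i).2)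
      (fun i hi => (hlt i hi).le) hx
    rw [h x hxS] at hmem
    exact (p (ℓ + 1)).2.top_notMem hmem
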